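/- Let A′ and A″ be homotopy Gerstenhaber algebras over Z/2 with twisting cochains E′, E″, and equip A = A′⊗A″ with the Hirsch algebra multiplication · on B̄A of the tensor-product construction. Then this multiplication is not associative in general, but for elements a = a′⊗a″, b = b′⊗b″, c = c′⊗c″ ∈ A one has ([a]·[b])·[c] + [a]·([b]·[c]) = d(h)([a],[b],[c]), where h([a],[b],[c]) = [a′E′([b′],[c′]) ⊗ E″([a″],[c″|b″])] + [E′([a′],[b′|c′]) ⊗ E″([b″],[c″])a″] ∈ B̄₁A. -/

import Mathlib

open scoped TensorProduct

noncomputable section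

/-- The sign `(-1)^n` as an integer, for `n : ℤ`. -/
def pm (n : ℤ) : ℤ := (((-1 : ℤˣ) ^ n : ℤˣ) : ℤ)

/-- The total desuspended degree `Σᵢ (nᵢ - 1)` of a list of (cohomological) degrees;
this is the degree of the bar word `[a₁|⋯|a_k]` when `aᵢ` has degree `nᵢ`. -/
def bdeg (ds : List ℤ) : ℤ := (ds.map (fun n => n - 1)).sum

/-- An augmented, unital, associative differential graded algebra over a commutative
unital ring `R`, with cohomological grading (the differential has degree `+1`).
The grading is internal (`grading_internal`), multiplication and unit are graded,
the differential satisfies the graded Leibniz rule, and the augmentation is a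
map of augmented dg algebras.  The operator `sgn` is the canonical "sign" operator
multiplying the component of degree `i` by `(-1)^i`; it is uniquely determined by the
grading and is included as data for convenience (Koszul signs). -/
structure DGAlgebra (R : Type) [CommRing R] : Type 1 where
  carrier : Type
  [ring : Ring carrier]
  [alg : Algebra R carrier]
  grading : ℤ → Submodule R carrier
  grading_internal : DirectSum.IsInternal grading
  one_mem : (1 : carrier) ∈ grading 0
  mul_mem : ∀ {i j : ℤ} {a b : carrier},
    a ∈ grading i → b ∈ grading j → (a * b) ∈ grading (i + j)
  d : carrier →ₗ[R] carrier
  d_mem : ∀ {i : ℤ} {a : carrier}, a ∈ grading i → d a ∈ grading (i + 1)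
  d_sq : ∀ a, d (d a) = 0
  leibniz : ∀ {i : ℤ} {a b : carrier}, a ∈ grading i →
    d (a * b) = d a * b + pm i • (a * d b)
  aug : carrier →ₐ[R] R
  aug_d : ∀ a, aug (d a) = 0
  aug_graded : ∀ {i : ℤ} {a : carrier}, a ∈ grading i → i ≠ 0 → aug a = 0
  sgn : carrier →ₗ[R] carrier
  sgn_apply : ∀ {i : ℤ} {a : carrier}, a ∈ grading i → sgn a = pm i • a

attribute [instance] DGAlgebra.ring DGAlgebra.alg

namespace DGAlgebra

variable {R : Type} [CommRing R] (A : DGAlgebra R)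

/-- The unnormalized bar construction `BA = T(s⁻¹A)` of `A`, *as a graded `R`-module*.
At the level of (ungraded) `R`-modules it is the tensor algebra on the underlying
module of `A`; the word `[a₁|⋯|a_k]` is the product `ι a₁ ⋯ ι a_k`.  The
(de)suspension is invisible at the module level; it is accounted for by the degree
conventions (`bdeg`) and the sign operators. -/
abbrev Bar : Type := TensorAlgebra R A.carrier

/-- The bar word `[a₁|⋯|a_k] ∈ BA`. The empty word is the counit element `𝟙`. -/
def word (l : List A.carrier) : A.Bar := (l.map (TensorAlgebra.ι R)).prod

/-- `A.Homog l ds` says that the list `l` consists of homogeneous elements,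
`l i` having degree `ds i`. -/
def Homog (l : List A.carrier) (ds : List ℤ) : Prop :=
  l.length = ds.length ∧ ∀ i : ℕ, l.getD i 0 ∈ A.grading (ds.getD i 0)

/-- The concatenation operator `∇ : BA ⊗ BA → BA`. -/
def concat : A.Bar ⊗[R] A.Bar →ₗ[R] A.Bar := LinearMap.mul' R A.Bar

/-- The augmentation ideal `Ā ⊆ A`. -/
def augIdeal : Submodule R A.carrier := LinearMap.ker A.aug.toLinearMap

/-- The normalized bar construction `B̄A = T(s⁻¹Ā)`. -/
abbrev NBar : Type := TensorAlgebra R A.augIdeal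

/-- words in the normalized bar construction. -/
def nword (l : List A.augIdeal) : A.NBar := (l.map (TensorAlgebra.ι R)).prod

/-- The canonical inclusion `B̄A → BA`. -/
def nincl : A.NBar →ₗ[R] A.Bar :=
  (TensorAlgebra.lift R ((TensorAlgebra.ι R) ∘ₗ A.augIdeal.subtype)).toLinearMap

/-- The (internal, total-degree) grading of the bar construction:
`(BA)_n` is spanned by the homogeneous words of total desuspended degree `n`. -/
def barGrading (n : ℤ) : Submodule R A.Bar :=
  Submodule.span R {x | ∃ l ds, A.Homog l ds ∧ bdeg ds = n ∧ x = A.word l}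

end DGAlgebra

/-- All the canonical structure carried by the bar construction `BA` of an augmented
dg algebra `A`: the deconcatenation coproduct `Δ`, the bar differential `dB`
(tensor-product differential plus the `∂` multiplying adjacent entries through the
desuspended multiplication), the sign operator `sgnB`, the graded twist `tw`, the
canonical twisting cochain `α` (projection to `B₁A = s⁻¹A` followed by `σ`), and the
counit `εB`.  Each operator is uniquely determined by its prescribed values on the
words `[a₁|⋯|a_k]`, which span `BA`. -/
structure BarData {R : Type} [CommRing R] (A : DGAlgebra R) : Type where
  /-- deconcatenation coproduct -/
  Δ : A.Bar →ₗ[R] A.Bar ⊗[R] A.Bar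
  Δ_word : ∀ l : List A.carrier,
    Δ (A.word l) = ∑ i ∈ Finset.range (l.length + 1),
      A.word (l.take i) ⊗ₜ[R] A.word (l.drop i)
  /-- the bar differential -/
  dB : A.Bar →ₗ[R] A.Bar
  dB_word : ∀ (l : List A.carrier) (ds : List ℤ), A.Homog l ds →
    dB (A.word l) =
      - (∑ i ∈ Finset.range l.length,
          pm (bdeg (ds.take i)) • A.word (l.set i (A.d (l.getD i 0))))
      + ∑ i ∈ Finset.range (l.length - 1),
          pm (bdeg (ds.take (i + 1))) •
            A.word (l.take i ++ (l.getD i 0 * l.getD (i + 1) 0) :: l.drop (i + 2))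
  /-- the sign operator of `BA` -/
  sgnB : A.Bar →ₗ[R] A.Bar
  sgnB_word : ∀ (l : List A.carrier) (ds : List ℤ), A.Homog l ds →
    sgnB (A.word l) = pm (bdeg ds) • A.word l
  /-- the graded (Koszul) twist `BA ⊗ BA → BA ⊗ BA` -/
  tw : A.Bar ⊗[R] A.Bar →ₗ[R] A.Bar ⊗[R] A.Bar
  tw_word : ∀ (l m : List A.carrier) (ds es : List ℤ), A.Homog l ds → A.Homog m es →
    tw (A.word l ⊗ₜ[R] A.word m) = pm (bdeg ds * bdeg es) • (A.word m ⊗ₜ[R] A.word l)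
  /-- the canonical twisting cochain `α : BA → A` -/
  α : A.Bar →ₗ[R] A.carrier
  α_single : ∀ a : A.carrier, α (A.word [a]) = a
  α_word : ∀ l : List A.carrier, l.length ≠ 1 → α (A.word l) = 0
  /-- the counit of `BA` -/
  εB : A.Bar →ₗ[R] R
  εB_one : εB (1 : A.Bar) = 1
  εB_word : ∀ l : List A.carrier, l ≠ [] → εB (A.word l) = 0

namespace BarData

variable {R : Type} [CommRing R] {A : DGAlgebra R} (BD : BarData A)

/-- `sgnB` raised to the power `n` (only the parity of `n` matters);
used to express Koszul signs `(-1)^{n·|x|}`. -/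
def sgnPow (n : ℤ) : A.Bar →ₗ[R] A.Bar :=
  if n % 2 = 0 then LinearMap.id else BD.sgnB

/-- The differential of `BA ⊗ BA` (with the Koszul sign rule). -/
def dBB : A.Bar ⊗[R] A.Bar →ₗ[R] A.Bar ⊗[R] A.Bar :=
  TensorProduct.map BD.dB LinearMap.id + TensorProduct.map BD.sgnB BD.dB

/-- The middle interchange `1 ⊗ tw ⊗ 1` on `(BA ⊗ BA) ⊗ (BA ⊗ BA)`
(the graded twist of the two middle factors). -/
def midTw : (A.Bar ⊗[R] A.Bar) ⊗[R] (A.Bar ⊗[R] A.Bar) →ₗ[R]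
    (A.Bar ⊗[R] A.Bar) ⊗[R] (A.Bar ⊗[R] A.Bar) :=
  let e₁ := TensorProduct.assoc R A.Bar A.Bar (A.Bar ⊗[R] A.Bar)
  let e₂ := TensorProduct.congr (LinearEquiv.refl R A.Bar)
    (TensorProduct.assoc R A.Bar A.Bar A.Bar).symm
  e₁.symm.toLinearMap ∘ₗ e₂.symm.toLinearMap ∘ₗ
    (TensorProduct.map LinearMap.id (TensorProduct.map BD.tw LinearMap.id)) ∘ₗ
    e₂.toLinearMap ∘ₗ e₁.toLinearMap

/-- The coproduct of `BA ⊗ BA` (with Koszul signs). -/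
def ΔBB : A.Bar ⊗[R] A.Bar →ₗ[R] (A.Bar ⊗[R] A.Bar) ⊗[R] (A.Bar ⊗[R] A.Bar) :=
  BD.midTw ∘ₗ TensorProduct.map BD.Δ BD.Δ

/-- The counit of `BA ⊗ BA`. -/
def εBB : A.Bar ⊗[R] A.Bar →ₗ[R] R :=
  (TensorProduct.lid R R).toLinearMap ∘ₗ TensorProduct.map BD.εB BD.εB

/-- The twisting cochain `β = ε_{BA} ⊗ α : BA ⊗ BA → A`. -/
def β : A.Bar ⊗[R] A.Bar →ₗ[R] A.carrier :=
  (TensorProduct.lid R A.carrier).toLinearMap ∘ₗ TensorProduct.map BD.εB BD.α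

end BarData

/-- `E : BA ⊗ BA → A` is a twisting cochain: it has degree `+1`, satisfies
`E(𝟙,-) = E(-,𝟙) = α` and the twisting cochain equation `d(E) = E ∪ E`,
written as `d∘E + E∘d_{BA⊗BA} = μ_A (E ⊗ E) Δ_{BA⊗BA}` (all Koszul signs being
expressed via the sign operators). -/
structure IsTwistingCochain {R : Type} [CommRing R] {A : DGAlgebra R} (BD : BarData A)
    (E : A.Bar ⊗[R] A.Bar →ₗ[R] A.carrier) : Prop where
  degree : ∀ (l m : List A.carrier) (ds es : List ℤ), A.Homog l ds → A.Homog m es →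
    E (A.word l ⊗ₜ[R] A.word m) ∈ A.grading (bdeg ds + bdeg es + 1)
  unit_left : ∀ b : A.Bar, E ((1 : A.Bar) ⊗ₜ[R] b) = BD.α b
  unit_right : ∀ a : A.Bar, E (a ⊗ₜ[R] (1 : A.Bar)) = BD.α a
  twist : A.d ∘ₗ E + E ∘ₗ BD.dBB =
    LinearMap.mul' R A.carrier ∘ₗ
      TensorProduct.map (E ∘ₗ TensorProduct.map BD.sgnB BD.sgnB) E ∘ₗ BD.ΔBB

/-- A twisting cochain is *normalized* if `E([1],𝟙) = E(𝟙,[1]) = 1`, if `E(a,b) = 0`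
whenever the total bar length is `> 1` and some entry equals `1 ∈ A`, and if
`E(a,b)` lies in the augmentation ideal whenever the total bar length is `> 1`. -/
structure IsNormalized {R : Type} [CommRing R] {A : DGAlgebra R}
    (E : A.Bar ⊗[R] A.Bar →ₗ[R] A.carrier) : Prop where
  one_right : E (A.word [(1 : A.carrier)] ⊗ₜ[R] (1 : A.Bar)) = 1
  one_left : E ((1 : A.Bar) ⊗ₜ[R] A.word [(1 : A.carrier)]) = 1
  vanish : ∀ l m : List A.carrier, 1 < l.length + m.length →
    ((1 : A.carrier) ∈ l ∨ (1 : A.carrier) ∈ m) → E (A.word l ⊗ₜ[R] A.word m) = 0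
  aug_ideal : ∀ l m : List A.carrier, 1 < l.length + m.length →
    A.aug (E (A.word l ⊗ₜ[R] A.word m)) = 0

/-- A twisting cochain has *level 3* if `E(a,b) = 0` whenever `a` has bar length `> 1`. -/
def IsLevel3 {R : Type} [CommRing R] {A : DGAlgebra R}
    (E : A.Bar ⊗[R] A.Bar →ₗ[R] A.carrier) : Prop :=
  ∀ (l m : List A.carrier), 1 < l.length → E (A.word l ⊗ₜ[R] A.word m) = 0

/-- A multiplication on the unnormalized bar construction `BA`: a morphism of
dg coalgebras `BA ⊗ BA → BA` of degree `0` having the counit element `𝟙` as a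
two-sided unit (associativity is *not* required). -/
structure BarMult {R : Type} [CommRing R] {A : DGAlgebra R} (BD : BarData A) : Type where
  f : A.Bar ⊗[R] A.Bar →ₗ[R] A.Bar
  one_mul : ∀ b : A.Bar, f ((1 : A.Bar) ⊗ₜ[R] b) = b
  mul_one : ∀ a : A.Bar, f (a ⊗ₜ[R] (1 : A.Bar)) = a
  graded : ∀ (l m : List A.carrier) (ds es : List ℤ), A.Homog l ds → A.Homog m es →
    f (A.word l ⊗ₜ[R] A.word m) ∈ A.barGrading (bdeg ds + bdeg es)
  chain : BD.dB ∘ₗ f = f ∘ₗ BD.dBB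
  counit : BD.εB ∘ₗ f = BD.εBB
  coalg : BD.Δ ∘ₗ f = TensorProduct.map f f ∘ₗ BD.ΔBB


namespace DGAlgebra

variable {R : Type} [CommRing R] (A : DGAlgebra R)

/-- The differential of `A` restricted to the augmentation ideal. -/
def kD : A.augIdeal →ₗ[R] A.augIdeal :=
  A.d.restrict (p := A.augIdeal) (q := A.augIdeal) (fun x _ => by
    simp only [augIdeal, LinearMap.mem_ker, AlgHom.toLinearMap_apply]
    exact A.aug_d x)

/-- The product of two elements of the augmentation ideal. -/
def kMul (x y : A.augIdeal) : A.augIdeal :=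
  ⟨(x : A.carrier) * (y : A.carrier), by
    have hx : A.aug (x : A.carrier) = 0 := by
      have := x.2; simp only [augIdeal, LinearMap.mem_ker, AlgHom.toLinearMap_apply] at this; exact this
    simp only [augIdeal, LinearMap.mem_ker, AlgHom.toLinearMap_apply, map_mul, hx, zero_mul]⟩

/-- Homogeneity for lists of elements of the augmentation ideal. -/
def HomogN (l : List A.augIdeal) (ds : List ℤ) : Prop :=
  l.length = ds.length ∧ ∀ i : ℕ, ((l.getD i 0 : A.augIdeal) : A.carrier) ∈ A.grading (ds.getD i 0)

/-- The internal grading of the normalized bar construction. -/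
def nbarGrading (n : ℤ) : Submodule R A.NBar :=
  Submodule.span R {x | ∃ l ds, A.HomogN l ds ∧ bdeg ds = n ∧ x = A.nword l}

end DGAlgebra

/-- The canonical structure of the *normalized* bar construction `B̄A = T(s⁻¹Ā)`:
deconcatenation coproduct, bar differential, sign operator, graded twist, canonical
twisting cochain (with values in the augmentation ideal) and counit, each determined by
its values on words. -/
structure NBarData {R : Type} [CommRing R] (A : DGAlgebra R) : Type where
  Δn : A.NBar →ₗ[R] A.NBar ⊗[R] A.NBar
  Δn_word : ∀ l : List A.augIdeal,
    Δn (A.nword l) = ∑ i ∈ Finset.range (l.length + 1),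
      A.nword (l.take i) ⊗ₜ[R] A.nword (l.drop i)
  dn : A.NBar →ₗ[R] A.NBar
  dn_word : ∀ (l : List A.augIdeal) (ds : List ℤ), A.HomogN l ds →
    dn (A.nword l) =
      - (∑ i ∈ Finset.range l.length,
          pm (bdeg (ds.take i)) • A.nword (l.set i (A.kD (l.getD i 0))))
      + ∑ i ∈ Finset.range (l.length - 1),
          pm (bdeg (ds.take (i + 1))) •
            A.nword (l.take i ++ A.kMul (l.getD i 0) (l.getD (i + 1) 0) :: l.drop (i + 2))
  sgnN : A.NBar →ₗ[R] A.NBar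
  sgnN_word : ∀ (l : List A.augIdeal) (ds : List ℤ), A.HomogN l ds →
    sgnN (A.nword l) = pm (bdeg ds) • A.nword l
  twN : A.NBar ⊗[R] A.NBar →ₗ[R] A.NBar ⊗[R] A.NBar
  twN_word : ∀ (l m : List A.augIdeal) (ds es : List ℤ), A.HomogN l ds → A.HomogN m es →
    twN (A.nword l ⊗ₜ[R] A.nword m) = pm (bdeg ds * bdeg es) • (A.nword m ⊗ₜ[R] A.nword l)
  αn : A.NBar →ₗ[R] A.augIdeal
  αn_single : ∀ a : A.augIdeal, αn (A.nword [a]) = a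
  αn_word : ∀ l : List A.augIdeal, l.length ≠ 1 → αn (A.nword l) = 0
  εn : A.NBar →ₗ[R] R
  εn_one : εn (1 : A.NBar) = 1
  εn_word : ∀ l : List A.augIdeal, l ≠ [] → εn (A.nword l) = 0

namespace NBarData

variable {R : Type} [CommRing R] {A : DGAlgebra R} (ND : NBarData A)

/-- differential of `B̄A ⊗ B̄A`. -/
def dnBB : A.NBar ⊗[R] A.NBar →ₗ[R] A.NBar ⊗[R] A.NBar :=
  TensorProduct.map ND.dn LinearMap.id + TensorProduct.map ND.sgnN ND.dn

/-- middle interchange `1 ⊗ tw ⊗ 1` for the normalized bar construction. -/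
def midTwN : (A.NBar ⊗[R] A.NBar) ⊗[R] (A.NBar ⊗[R] A.NBar) →ₗ[R]
    (A.NBar ⊗[R] A.NBar) ⊗[R] (A.NBar ⊗[R] A.NBar) :=
  let e₁ := TensorProduct.assoc R A.NBar A.NBar (A.NBar ⊗[R] A.NBar)
  let e₂ := TensorProduct.congr (LinearEquiv.refl R A.NBar)
    (TensorProduct.assoc R A.NBar A.NBar A.NBar).symm
  e₁.symm.toLinearMap ∘ₗ e₂.symm.toLinearMap ∘ₗ
    (TensorProduct.map LinearMap.id (TensorProduct.map ND.twN LinearMap.id)) ∘ₗ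
    e₂.toLinearMap ∘ₗ e₁.toLinearMap

/-- coproduct of `B̄A ⊗ B̄A`. -/
def ΔnBB : A.NBar ⊗[R] A.NBar →ₗ[R] (A.NBar ⊗[R] A.NBar) ⊗[R] (A.NBar ⊗[R] A.NBar) :=
  ND.midTwN ∘ₗ TensorProduct.map ND.Δn ND.Δn

/-- counit of `B̄A ⊗ B̄A`. -/
def εnBB : A.NBar ⊗[R] A.NBar →ₗ[R] R :=
  (TensorProduct.lid R R).toLinearMap ∘ₗ TensorProduct.map ND.εn ND.εn

end NBarData

/-- A multiplication on the normalized bar construction `B̄A`: a morphism of dg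
coalgebras `B̄A ⊗ B̄A → B̄A` of degree `0` with the counit element `𝟙` as two-sided
unit (associativity not required). -/
structure NBarMult {R : Type} [CommRing R] {A : DGAlgebra R} (ND : NBarData A) : Type where
  f : A.NBar ⊗[R] A.NBar →ₗ[R] A.NBar
  one_mul : ∀ b : A.NBar, f ((1 : A.NBar) ⊗ₜ[R] b) = b
  mul_one : ∀ a : A.NBar, f (a ⊗ₜ[R] (1 : A.NBar)) = a
  graded : ∀ (l m : List A.augIdeal) (ds es : List ℤ), A.HomogN l ds → A.HomogN m es →
    f (A.nword l ⊗ₜ[R] A.nword m) ∈ A.nbarGrading (bdeg ds + bdeg es)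
  chain : ND.dn ∘ₗ f = f ∘ₗ ND.dnBB
  counit : ND.εn ∘ₗ f = ND.εnBB
  coalg : ND.Δn ∘ₗ f = TensorProduct.map f f ∘ₗ ND.ΔnBB

/-- The tensor product dg algebra `A = A' ⊗ A''` of two augmented dg algebras, with the
graded (Koszul) multiplication `(a'⊗a'')(b'⊗b'') = (-1)^{|a''||b'|} a'b' ⊗ a''b''`,
tensor-product differential, grading and augmentation.  It is presented as a dg algebra
`A` together with a linear isomorphism `e : A ≅ A' ⊗ A''` identifying all structure. -/
structure TensorDGA {R : Type} [CommRing R] (A' A'' : DGAlgebra R) : Type 1 where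
  A : DGAlgebra R
  e : A.carrier ≃ₗ[R] A'.carrier ⊗[R] A''.carrier
  mul_compat : ∀ {i'' j' : ℤ} (a' : A'.carrier) {a'' : A''.carrier} {b' : A'.carrier}
    (b'' : A''.carrier), a'' ∈ A''.grading i'' → b' ∈ A'.grading j' →
    e.symm (a' ⊗ₜ[R] a'') * e.symm (b' ⊗ₜ[R] b'') =
      pm (i'' * j') • e.symm ((a' * b') ⊗ₜ[R] (a'' * b''))
  one_def : e.symm ((1 : A'.carrier) ⊗ₜ[R] (1 : A''.carrier)) = 1
  grading_compat : ∀ {i' i'' : ℤ} {a' : A'.carrier} {a'' : A''.carrier},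
    a' ∈ A'.grading i' → a'' ∈ A''.grading i'' → e.symm (a' ⊗ₜ[R] a'') ∈ A.grading (i' + i'')
  d_compat : ∀ {i' : ℤ} (a'' : A''.carrier) {a' : A'.carrier}, a' ∈ A'.grading i' →
    A.d (e.symm (a' ⊗ₜ[R] a'')) =
      e.symm ((A'.d a') ⊗ₜ[R] a'') + pm i' • e.symm (a' ⊗ₜ[R] (A''.d a''))
  aug_compat : ∀ (a' : A'.carrier) (a'' : A''.carrier),
    A.aug (e.symm (a' ⊗ₜ[R] a'')) = A'.aug a' * A''.aug a''

namespace TensorDGA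

variable {R : Type} [CommRing R] {A' A'' : DGAlgebra R} (T : TensorDGA A' A'')

/-- The list `[a'₁⊗a''₁ | ⋯ | a'_k⊗a''_k]` of entries of `A = A' ⊗ A''`. -/
def mixList (l' : List A'.carrier) (l'' : List A''.carrier) : List T.A.carrier :=
  List.zipWith (fun x y => T.e.symm (x ⊗ₜ[R] y)) l' l''

end TensorDGA

/-- The Koszul sign exponent `Σ_{i>j} (|b'_i| - 1)·|b''_j|` appearing in the definition
of the map `Ẽ' ⊗ μ_{A''} : B(A'⊗A'') → A'⊗A''`. -/
def koszulExpL (ds' ds'' : List ℤ) (k : ℕ) : ℤ :=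
  ∑ p ∈ (Finset.range k ×ˢ Finset.range k).filter (fun p => p.2 < p.1),
    (ds'.getD p.1 0 - 1) * ds''.getD p.2 0

/-- The Koszul sign exponent `Σ_{i>j} |b'_i|·(|b''_j| - 1)` appearing in the definition
of the map `μ_{A'} ⊗ Ẽ'' : B(A'⊗A'') → A'⊗A''`. -/
def koszulExpR (ds' ds'' : List ℤ) (k : ℕ) : ℤ :=
  ∑ p ∈ (Finset.range k ×ˢ Finset.range k).filter (fun p => p.2 < p.1),
    ds'.getD p.1 0 * (ds''.getD p.2 0 - 1)

section Construction

variable {R : Type} [CommRing R] {A' A'' : DGAlgebra R} (T : TensorDGA A' A'')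
  (BD : BarData T.A)

/-- The operator `G_{[a₁]} = ((E'_{[a'₁]} ⊗ μ_{A''}) ⊗ 1 ⊗ (μ_{A'} ⊗ E''_{[a''₁]})) Δ⁽³⁾`,
where `F₁ = E'_{[a'₁]} ⊗ μ_{A''}` and `F₃ = μ_{A'} ⊗ E''_{[a''₁]}` (the Koszul sign of
the degree-`|a''₁|` map `F₃` passing the first two tensor factors being expressed by
`sgnPow n''`). -/
def Gone (F₁ F₃ : T.A.Bar →ₗ[R] T.A.carrier) (n'' : ℤ) :
    T.A.Bar →ₗ[R] T.A.carrier ⊗[R] (T.A.Bar ⊗[R] T.A.carrier) :=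
  TensorProduct.map (F₁ ∘ₗ BD.sgnPow n'') (TensorProduct.map (BD.sgnPow n'') F₃) ∘ₗ
    TensorProduct.map LinearMap.id BD.Δ ∘ₗ BD.Δ

/-- The operator
`M(Ẽ', Ẽ'', G̃) = (1⊗1⊗μ_A)((Ẽ'⊗μ_{A''})⊗1⊗(μ_{A'}⊗Ẽ'')⊗1)(1⊗Δ∇⁽³⁾⊗1)(1⊗1⊗(σ⁻¹⊗1⊗1)G̃)Δ⁽³⁾`
of the construction, where `F₁ = Ẽ' ⊗ μ_{A''}` (a map of degree `n'`),
`F₃ = μ_{A'} ⊗ Ẽ''` (degree `n''`), `g` is the degree of `G̃`, `σ⁻¹` is realized by the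
canonical inclusion `ι : s⁻¹A → BA`, and all Koszul signs are expressed via `sgnPow`. -/
def Mop (F₁ F₃ : T.A.Bar →ₗ[R] T.A.carrier) (n'' g : ℤ)
    (Gt : T.A.Bar →ₗ[R] T.A.carrier ⊗[R] (T.A.Bar ⊗[R] T.A.carrier)) :
    T.A.Bar →ₗ[R] T.A.carrier ⊗[R] (T.A.Bar ⊗[R] T.A.carrier) :=
  -- `(σ⁻¹ ⊗ 1 ⊗ 1) G̃ : BA → BA ⊗ (BA ⊗ A)`
  let Gt' : T.A.Bar →ₗ[R] T.A.Bar ⊗[R] (T.A.Bar ⊗[R] T.A.carrier) :=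
    TensorProduct.map (TensorAlgebra.ι R) LinearMap.id ∘ₗ Gt
  -- `x₂ ⊗ (y₁ ⊗ (y₂ ⊗ y₃)) ↦ Δ ∇⁽³⁾(x₂ ⊗ y₁ ⊗ y₂) ⊗ y₃`
  let inner : T.A.Bar ⊗[R] (T.A.Bar ⊗[R] (T.A.Bar ⊗[R] T.A.carrier)) →ₗ[R]
      T.A.Bar ⊗[R] (T.A.Bar ⊗[R] T.A.carrier) :=
    (TensorProduct.assoc R T.A.Bar T.A.Bar T.A.carrier).toLinearMap ∘ₗ
    TensorProduct.map BD.Δ LinearMap.id ∘ₗ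
    TensorProduct.map (T.A.concat ∘ₗ TensorProduct.map T.A.concat LinearMap.id)
      LinearMap.id ∘ₗ
    (TensorProduct.assoc R (T.A.Bar ⊗[R] T.A.Bar) T.A.Bar T.A.carrier).symm.toLinearMap ∘ₗ
    (TensorProduct.assoc R T.A.Bar T.A.Bar (T.A.Bar ⊗[R] T.A.carrier)).symm.toLinearMap
  TensorProduct.map (F₁ ∘ₗ BD.sgnPow n'')
      (TensorProduct.map (BD.sgnPow n'')
        (LinearMap.mul' R T.A.carrier ∘ₗ TensorProduct.map F₃ LinearMap.id)) ∘ₗ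
    TensorProduct.map LinearMap.id inner ∘ₗ
    TensorProduct.map (BD.sgnPow (g - 1)) (TensorProduct.map (BD.sgnPow (g - 1)) Gt') ∘ₗ
    TensorProduct.map LinearMap.id BD.Δ ∘ₗ BD.Δ

/-- The augmentation `ε_{B(A,A,A)} : A ⊗ BA ⊗ A → A ⊗_A A = A` of the two-sided bar
construction: it kills bar length `≥ 1` and multiplies the outer factors. -/
def εBAAA : T.A.carrier ⊗[R] (T.A.Bar ⊗[R] T.A.carrier) →ₗ[R] T.A.carrier :=
  LinearMap.mul' R T.A.carrier ∘ₗ TensorProduct.map LinearMap.id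
    ((TensorProduct.lid R T.A.carrier).toLinearMap ∘ₗ TensorProduct.map BD.εB LinearMap.id)

end Construction

/-- The data of the construction of Section 3: the maps `Ẽ' ⊗ μ_{A''}` and
`μ_{A'} ⊗ Ẽ''` (as operators `BA → A` characterized by their values on homogeneous
words of pure tensors, with the Koszul reordering signs), and the maps
`G_a : BA → B(A,A,A) = A ⊗ BA ⊗ A`, linear in `a`, determined by the recursion
`G_{[a₁]} = ((E'_{[a'₁]}⊗μ)⊗1⊗(μ⊗E''_{[a''₁]}))Δ⁽³⁾` and
`G_a = M(E'_{[a'₁]}, E''_{[a''₁]}, G_{[a₂|⋯|a_k]})` for bar length `k > 1`. -/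
structure GData {R : Type} [CommRing R] {A' A'' : DGAlgebra R}
    (BD' : BarData A') (BD'' : BarData A'') (T : TensorDGA A' A'') (BD : BarData T.A)
    (E' : A'.Bar ⊗[R] A'.Bar →ₗ[R] A'.carrier)
    (E'' : A''.Bar ⊗[R] A''.Bar →ₗ[R] A''.carrier) : Type where
  Emu : (A'.Bar →ₗ[R] A'.carrier) → (T.A.Bar →ₗ[R] T.A.carrier)
  Emu_word : ∀ (F : A'.Bar →ₗ[R] A'.carrier) (l' : List A'.carrier)
    (l'' : List A''.carrier) (ds' ds'' : List ℤ), l'.length = l''.length →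
    A'.Homog l' ds' → A''.Homog l'' ds'' →
    Emu F (T.A.word (T.mixList l' l'')) =
      pm (koszulExpL ds' ds'' l'.length) • T.e.symm (F (A'.word l') ⊗ₜ[R] l''.prod)
  muE : (A''.Bar →ₗ[R] A''.carrier) → (T.A.Bar →ₗ[R] T.A.carrier)
  muE_word : ∀ (F : A''.Bar →ₗ[R] A''.carrier) (l' : List A'.carrier)
    (l'' : List A''.carrier) (ds' ds'' : List ℤ), l'.length = l''.length →
    A'.Homog l' ds' → A''.Homog l'' ds'' →
    muE F (T.A.word (T.mixList l' l'')) =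
      pm (koszulExpR ds' ds'' l'.length) • T.e.symm (l'.prod ⊗ₜ[R] F (A''.word l''))
  G : T.A.Bar →ₗ[R] T.A.Bar →ₗ[R] T.A.carrier ⊗[R] (T.A.Bar ⊗[R] T.A.carrier)
  G_nil : G (T.A.word []) = 0
  G_single : ∀ {n' n'' : ℤ} (a' : A'.carrier) (a'' : A''.carrier),
    a' ∈ A'.grading n' → a'' ∈ A''.grading n'' →
    G (T.A.word [T.e.symm (a' ⊗ₜ[R] a'')]) =
      Gone T BD
        (Emu (E' ∘ₗ TensorProduct.mk R A'.Bar A'.Bar (A'.word [a'])))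
        (muE (E'' ∘ₗ TensorProduct.mk R A''.Bar A''.Bar (A''.word [a''])))
        n''
  G_cons : ∀ {n' n'' : ℤ} (a' : A'.carrier) (a'' : A''.carrier)
    (rest : List T.A.carrier) (ds : List ℤ),
    a' ∈ A'.grading n' → a'' ∈ A''.grading n'' → T.A.Homog rest ds → rest ≠ [] →
    G (T.A.word (T.e.symm (a' ⊗ₜ[R] a'') :: rest)) =
      Mop T BD
        (Emu (E' ∘ₗ TensorProduct.mk R A'.Bar A'.Bar (A'.word [a'])))
        (muE (E'' ∘ₗ TensorProduct.mk R A''.Bar A''.Bar (A''.word [a''])))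
        n'' (bdeg ds + 1)
        (G (T.A.word rest))

/-- The twisting cochain `E : BA ⊗ BA → A` of the construction:
`E(𝟙, b) = α(b)` and `E(a, b) = ε_{B(A,A,A)}(G_a(b))` for `a` of bar length `≥ 1`. -/
def Econstr {R : Type} [CommRing R] {A' A'' : DGAlgebra R}
    {BD' : BarData A'} {BD'' : BarData A''} {T : TensorDGA A' A''} {BD : BarData T.A}
    {E' : A'.Bar ⊗[R] A'.Bar →ₗ[R] A'.carrier}
    {E'' : A''.Bar ⊗[R] A''.Bar →ₗ[R] A''.carrier}
    (GD : GData BD' BD'' T BD E' E'') : T.A.Bar ⊗[R] T.A.Bar →ₗ[R] T.A.carrier :=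
  εBAAA T BD ∘ₗ TensorProduct.lift GD.G +
    (TensorProduct.lid R T.A.carrier).toLinearMap ∘ₗ TensorProduct.map BD.εB BD.α

/-- The associativity homotopy
`h([a],[b],[c]) = [a'E'([b'],[c']) ⊗ E''([a''],[c''|b''])]
                + [E'([a'],[b'|c']) ⊗ E''([b''],[c''])a'']  ∈ B̄₁A`
of the Remark, as a function of the six tensor components (over `ℤ/2`). -/
def hTerm {A' A'' : DGAlgebra (ZMod 2)} (T : TensorDGA A' A'')
    (E' : A'.Bar ⊗[ZMod 2] A'.Bar →ₗ[ZMod 2] A'.carrier)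
    (E'' : A''.Bar ⊗[ZMod 2] A''.Bar →ₗ[ZMod 2] A''.carrier)
    (a' b' c' : A'.carrier) (a'' b'' c'' : A''.carrier) : T.A.Bar :=
  T.A.word [T.e.symm ((a' * E' (A'.word [b'] ⊗ₜ[ZMod 2] A'.word [c'])) ⊗ₜ[ZMod 2]
      E'' (A''.word [a''] ⊗ₜ[ZMod 2] A''.word [c'', b'']))]
  + T.A.word [T.e.symm (E' (A'.word [a'] ⊗ₜ[ZMod 2] A'.word [b', c']) ⊗ₜ[ZMod 2]
      (E'' (A''.word [b''] ⊗ₜ[ZMod 2] A''.word [c'']) * a''))]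


theorem pm_smul {M : Type*} [AddCommGroup M] [Module (ZMod 2) M] (n : ℤ) (x : M) :
    pm n • x = x := by
  unfold pm
  rcases Int.units_eq_one_or ((-1 : ℤˣ) ^ n) with h | h <;> rw [h]
  · simp
  · simpa using ZModModule.neg_eq_self x

namespace DGAlgebra
theorem ind {R : Type} [CommRing R] (A : DGAlgebra R) {P : A.carrier → Prop} (x : A.carrier)
    (hh : ∀ i x, x ∈ A.grading i → P x) (h0 : P 0) (hadd : ∀ x y, P x → P y → P (x + y)) :
    P x := by
  have : x ∈ iSup A.grading := by
    rw [A.grading_internal.submodule_iSup_eq_top]; trivial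
  exact Submodule.iSup_induction A.grading (motive := P) this hh h0 hadd

theorem homog_nil {R : Type} [CommRing R] (A : DGAlgebra R) : A.Homog [] [] := by
  refine ⟨rfl, fun i => by simp⟩

theorem homog_cons {R : Type} [CommRing R] (A : DGAlgebra R) {x : A.carrier} {l ds} {i : ℤ}
    (hx : x ∈ A.grading i) (h : A.Homog l ds) : A.Homog (x :: l) (i :: ds) := by
  refine ⟨by simp [h.1], fun j => ?_⟩
  cases j with
  | zero => simpa using hx
  | succ j => simpa using h.2 j

theorem word_span {R : Type} [CommRing R] (A : DGAlgebra R) (z : A.Bar) :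
    z ∈ Submodule.span R (Set.range A.word) := by
  induction z using TensorAlgebra.induction with
  | algebraMap r =>
    rw [Algebra.algebraMap_eq_smul_one]
    exact Submodule.smul_mem _ _ (Submodule.subset_span ⟨[], by simp [word]⟩)
  | ι x => exact Submodule.subset_span ⟨[x], by simp [word]⟩
  | mul a b ha hb =>
    have h := Submodule.mul_mem_mul ha hb
    rw [Submodule.span_mul_span] at h
    refine Submodule.span_mono ?_ h
    rintro _ ⟨_, ⟨l, rfl⟩, _, ⟨m, rfl⟩, rfl⟩
    exact ⟨l ++ m, by simp [word]⟩
  | add a b ha hb => exact Submodule.add_mem _ ha hb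

theorem word_homog_ind {R : Type} [CommRing R] (A : DGAlgebra R) {M : Type*} [AddCommGroup M]
    [Module R M] (φ ψ : A.Bar →ₗ[R] M)
    (h : ∀ l ds, A.Homog l ds → φ (A.word l) = ψ (A.word l)) : φ = ψ := by
  have key : ∀ l : List A.carrier, ∀ (p : List A.carrier) (ds : List ℤ), A.Homog p ds →
      φ (A.word (p ++ l)) = ψ (A.word (p ++ l)) := by
    intro l
    induction l with
    | nil => intro p ds hp; simpa using h p ds hp
    | cons x l ih =>
      intro p ds hp
      refine A.ind (P := fun x => φ (A.word (p ++ x :: l)) = ψ (A.word (p ++ x :: l))) x ?_ ?_ ?_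
      · intro i x hx
        have : A.Homog (p ++ [x]) (ds ++ [i]) := by
          refine ⟨by simp [hp.1], fun j => ?_⟩
          rcases lt_trichotomy j p.length with hj | hj | hj
          · have := hp.2 j
            rw [List.getD_append _ _ _ _ hj, List.getD_append _ _ _ _ (hp.1 ▸ hj)]
            exact this
          · rw [List.getD_append_right _ _ _ _ hj.ge, List.getD_append_right _ _ _ _ (hp.1 ▸ hj.ge),
              ← hp.1]
            simpa [hj] using hx
          · have h0 : (p ++ [x]).getD j 0 = 0 := List.getD_eq_default _ _ (by simp; omega)
            rw [h0]
            exact Submodule.zero_mem _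
        simpa using ih _ _ this
      · simp [word]
      · intro x y hx hy
        simp only [word, List.map_append, List.map_cons, List.prod_append, List.prod_cons,
          map_add, add_mul, mul_add] at hx hy ⊢
        rw [hx, hy]
  have key' : ∀ l, φ (A.word l) = ψ (A.word l) := fun l => by
    simpa using key l [] [] A.homog_nil
  ext z
  have hz := A.word_span z
  induction hz using Submodule.span_induction with
  | mem x hx => obtain ⟨l, rfl⟩ := hx; exact key' l
  | zero => simp
  | add a b _ _ ha hb => rw [map_add, map_add, ha, hb]
  | smul r a _ ha => rw [map_smul, map_smul, ha]
end DGAlgebra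

namespace BarData
variable {A : DGAlgebra (ZMod 2)} (BD : BarData A)

local notation "ι₂" => TensorAlgebra.ι (ZMod 2)

theorem sgnB_id : BD.sgnB = LinearMap.id := by
  apply A.word_homog_ind
  intro l ds h
  rw [BD.sgnB_word l ds h, pm_smul]; rfl

theorem sgnPow_id (n : ℤ) : BD.sgnPow n = LinearMap.id := by
  unfold sgnPow
  rw [sgnB_id]; split <;> rfl

theorem tw_tmul (x y : A.Bar) : BD.tw (x ⊗ₜ y) = y ⊗ₜ x := by
  have h1 : ∀ l ds, A.Homog l ds → 
     BD.tw ∘ₗ TensorProduct.mk _ _ _ (A.word l) = (TensorProduct.mk (ZMod 2) _ _).flip (A.word l) := by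
    intro l ds hl
    apply A.word_homog_ind
    intro m es hm
    simp only [LinearMap.comp_apply, TensorProduct.mk_apply, LinearMap.flip_apply]
    rw [BD.tw_word l m ds es hl hm, pm_smul]
  have h2 : BD.tw ∘ₗ (TensorProduct.mk (ZMod 2) A.Bar A.Bar).flip y = TensorProduct.mk _ _ _ y := by
    apply A.word_homog_ind
    intro l ds hl
    have := congrArg (fun φ => φ y) (h1 l ds hl)
    simpa using this
  simpa using congrArg (fun φ => φ x) h2

theorem Δ0 : BD.Δ 1 = 1 ⊗ₜ 1 := by
  simpa [DGAlgebra.word] using BD.Δ_word []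
theorem Δ1 (a : A.carrier) : BD.Δ (ι₂ a) = 1 ⊗ₜ ι₂ a + ι₂ a ⊗ₜ 1 := by
  simpa [DGAlgebra.word, Finset.sum_range_succ] using BD.Δ_word [a]
theorem Δ2 (a b : A.carrier) : BD.Δ (ι₂ a * ι₂ b) =
    1 ⊗ₜ (ι₂ a * ι₂ b) + ι₂ a ⊗ₜ ι₂ b + (ι₂ a * ι₂ b) ⊗ₜ 1 := by
  simpa [DGAlgebra.word, Finset.sum_range_succ] using BD.Δ_word [a, b]
theorem α0 : BD.α 1 = 0 := by
  simpa [DGAlgebra.word] using BD.α_word []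
theorem α1 (a : A.carrier) : BD.α (ι₂ a) = a := by
  simpa [DGAlgebra.word] using BD.α_single a
theorem α2 (a b : A.carrier) : BD.α (ι₂ a * ι₂ b) = 0 := by
  simpa [DGAlgebra.word] using BD.α_word [a, b]
theorem ε1 (a : A.carrier) : BD.εB (ι₂ a) = 0 := by
  simpa [DGAlgebra.word] using BD.εB_word [a]
theorem ε2 (a b : A.carrier) : BD.εB (ι₂ a * ι₂ b) = 0 := by
  simpa [DGAlgebra.word] using BD.εB_word [a, b]

theorem dB0 : BD.dB 1 = 0 := by
  simpa [DGAlgebra.word] using BD.dB_word [] [] A.homog_nil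

theorem dB1 (a : A.carrier) : BD.dB (ι₂ a) = ι₂ (A.d a) := by
  refine A.ind (P := fun a => BD.dB (ι₂ a) = ι₂ (A.d a)) a ?_ (by simp)
    (fun x y hx hy => by simp [hx, hy])
  intro i a ha
  have := BD.dB_word [a] [i] (A.homog_cons ha A.homog_nil)
  simp only [pm_smul] at this
  simpa [DGAlgebra.word, ZModModule.neg_eq_self] using this

theorem dB2 (a b : A.carrier) : BD.dB (ι₂ a * ι₂ b) =
    ι₂ (A.d a) * ι₂ b + ι₂ a * ι₂ (A.d b) + ι₂ (a * b) := by
  refine A.ind (P := fun a => BD.dB (ι₂ a * ι₂ b) =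
    ι₂ (A.d a) * ι₂ b + ι₂ a * ι₂ (A.d b) + ι₂ (a * b)) a ?_ (by simp)
    (fun x y hx hy => by simp only [map_add, add_mul, hx, hy]; abel)
  intro i a ha
  refine A.ind (P := fun b => BD.dB (ι₂ a * ι₂ b) =
    ι₂ (A.d a) * ι₂ b + ι₂ a * ι₂ (A.d b) + ι₂ (a * b)) b ?_ (by simp)
    (fun x y hx hy => by simp only [map_add, mul_add, hx, hy]; abel)
  intro j b hb
  have := BD.dB_word [a, b] [i, j] (A.homog_cons ha (A.homog_cons hb A.homog_nil))
  simp only [pm_smul] at this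
  simpa [DGAlgebra.word, Finset.sum_range_succ, ZModModule.neg_eq_self] using this

theorem ΔBB_expand (x y : A.Bar) : BD.ΔBB (x ⊗ₜ y) = BD.midTw (BD.Δ x ⊗ₜ BD.Δ y) := rfl

theorem midTw_tmul (x y z w : A.Bar) :
    BD.midTw ((x ⊗ₜ y) ⊗ₜ (z ⊗ₜ w)) = (x ⊗ₜ z) ⊗ₜ (y ⊗ₜ w) := by
  simp [midTw, tw_tmul]

theorem P_eq : LinearMap.mul' (ZMod 2) A.Bar ∘ₗ
    TensorProduct.map (ι₂ ∘ₗ BD.α) LinearMap.id ∘ₗ BD.Δ +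
      (Algebra.linearMap (ZMod 2) A.Bar) ∘ₗ BD.εB = LinearMap.id := by
  apply A.word_homog_ind
  intro l ds _
  cases l with
  | nil => simp [DGAlgebra.word, Δ0, α0, BD.εB_one]
  | cons a l =>
    simp only [LinearMap.add_apply, LinearMap.comp_apply, BD.Δ_word, BD.εB_word (a :: l) (by simp),
      map_sum, TensorProduct.map_tmul, LinearMap.mul'_apply, LinearMap.id_apply, map_zero, add_zero]
    rw [Finset.sum_eq_single 1]
    · simp only [List.take_succ_cons, List.take_zero, List.drop_succ_cons, List.drop_zero,
        BD.α_single]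
      simp [DGAlgebra.word]
    · intro i hi h1
      rw [BD.α_word, map_zero, zero_mul]
      simp at hi ⊢
      omega
    · simp
end BarData

namespace BarMult
variable {A : DGAlgebra (ZMod 2)} {BD : BarData A} (f : BarMult BD)
local notation "ι₂" => TensorAlgebra.ι (ZMod 2)

theorem rec_eq (u : A.Bar ⊗[ZMod 2] A.Bar) :
    f.f u = LinearMap.mul' (ZMod 2) A.Bar (TensorProduct.map (ι₂ ∘ₗ BD.α ∘ₗ f.f) f.f (BD.ΔBB u))
      + algebraMap (ZMod 2) A.Bar (BD.εBB u) := by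
  have h1 := congrArg (fun φ => φ (f.f u)) BD.P_eq
  have h2 := congrArg (fun φ => φ u) f.coalg
  have h3 := congrArg (fun φ => φ u) f.counit
  simp only [LinearMap.add_apply, LinearMap.comp_apply, LinearMap.id_apply] at h1 h2 h3
  rw [h2, h3] at h1
  rw [← h1, ← LinearMap.comp_apply (TensorProduct.map _ _) (TensorProduct.map _ _),
    ← TensorProduct.map_comp]
  rfl

theorem f11 (a b : A.carrier) : f.f (ι₂ a ⊗ₜ ι₂ b) =
    ι₂ a * ι₂ b + ι₂ b * ι₂ a + ι₂ (BD.α (f.f (ι₂ a ⊗ₜ ι₂ b))) := by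
  refine (f.rec_eq _).trans ?_
  simp [BarData.ΔBB_expand, BarData.Δ1, TensorProduct.add_tmul, TensorProduct.tmul_add,
    BarData.midTw_tmul, f.one_mul, f.mul_one, BarData.α0, BarData.α1, BarData.εBB, BarData.ε1]
  abel

theorem f12 (a b c : A.carrier) : f.f (ι₂ a ⊗ₜ (ι₂ b * ι₂ c)) =
    ι₂ a * (ι₂ b * ι₂ c) + ι₂ b * f.f (ι₂ a ⊗ₜ ι₂ c) + ι₂ (BD.α (f.f (ι₂ a ⊗ₜ ι₂ b))) * ι₂ c
     + ι₂ (BD.α (f.f (ι₂ a ⊗ₜ (ι₂ b * ι₂ c)))) := by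
  refine (f.rec_eq _).trans ?_
  simp [BarData.ΔBB_expand, BarData.Δ1, BarData.Δ2, TensorProduct.add_tmul, TensorProduct.tmul_add,
    BarData.midTw_tmul, f.one_mul, f.mul_one, BarData.α0, BarData.α1, BarData.α2, BarData.εBB,
    BarData.ε1, BarData.ε2]
  abel

theorem f21 (a b c : A.carrier) : f.f ((ι₂ a * ι₂ b) ⊗ₜ ι₂ c) =
    ι₂ c * (ι₂ a * ι₂ b) + ι₂ a * f.f (ι₂ b ⊗ₜ ι₂ c) + ι₂ (BD.α (f.f (ι₂ a ⊗ₜ ι₂ c))) * ι₂ b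
     + ι₂ (BD.α (f.f ((ι₂ a * ι₂ b) ⊗ₜ ι₂ c))) := by
  refine (f.rec_eq _).trans ?_
  simp [BarData.ΔBB_expand, BarData.Δ1, BarData.Δ2, TensorProduct.add_tmul, TensorProduct.tmul_add,
    BarData.midTw_tmul, f.one_mul, f.mul_one, BarData.α0, BarData.α1, BarData.α2, BarData.εBB,
    BarData.ε1, BarData.ε2]
  abel
end BarMult

section HGA
variable {A : DGAlgebra (ZMod 2)} {BD : BarData A} (E : A.Bar ⊗[ZMod 2] A.Bar →ₗ[ZMod 2] A.carrier)
local notation "ι₂" => TensorAlgebra.ι (ZMod 2)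

theorem leib (A : DGAlgebra (ZMod 2)) (a b : A.carrier) : A.d (a * b) = A.d a * b + a * A.d b := by
  refine A.ind (P := fun a => A.d (a * b) = A.d a * b + a * A.d b) a ?_ (by simp)
    (fun x y hx hy => by simp only [map_add, add_mul, hx, hy]; abel)
  intro i a ha
  rw [A.leibniz ha, pm_smul]

variable {E}

theorem add_eq_of {M : Type*} [AddCommGroup M] [Module (ZMod 2) M] {x y z : M} (h : x + y = z) :
    x = y + z := by
  rw [← h, add_comm x y, ← add_assoc, ZModModule.add_self, zero_add]

theorem tw11 (hE : IsTwistingCochain BD E) (a b : A.carrier) :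
    A.d (E (ι₂ a ⊗ₜ ι₂ b)) = E (ι₂ (A.d a) ⊗ₜ ι₂ b) + E (ι₂ a ⊗ₜ ι₂ (A.d b)) + (a * b + b * a) := by
  apply add_eq_of
  have h := congrArg (fun φ => φ (ι₂ a ⊗ₜ ι₂ b)) hE.twist
  simp [BarData.dBB, BD.sgnB_id, BarData.ΔBB_expand, BarData.Δ1, TensorProduct.add_tmul,
    TensorProduct.tmul_add, BarData.midTw_tmul, BarData.dB1, hE.unit_left, hE.unit_right,
    BarData.α0, BarData.α1] at h
  rw [h]

theorem tw12 (hE : IsTwistingCochain BD E) (a b c : A.carrier) :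
    A.d (E (ι₂ a ⊗ₜ (ι₂ b * ι₂ c))) = E (ι₂ (A.d a) ⊗ₜ (ι₂ b * ι₂ c)) +
      E (ι₂ a ⊗ₜ (ι₂ (A.d b) * ι₂ c)) + E (ι₂ a ⊗ₜ (ι₂ b * ι₂ (A.d c))) + E (ι₂ a ⊗ₜ ι₂ (b * c))
      + (E (ι₂ a ⊗ₜ ι₂ b) * c + b * E (ι₂ a ⊗ₜ ι₂ c)) := by
  apply add_eq_of
  have h := congrArg (fun φ => φ (ι₂ a ⊗ₜ (ι₂ b * ι₂ c))) hE.twist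
  simp [BarData.dBB, BD.sgnB_id, BarData.ΔBB_expand, BarData.Δ1, BarData.Δ2, TensorProduct.add_tmul,
    TensorProduct.tmul_add, BarData.midTw_tmul, BarData.dB1, BarData.dB2, hE.unit_left,
    hE.unit_right, BarData.α0, BarData.α1, BarData.α2] at h
  rw [add_comm (E _ * c), ← h]; abel

theorem lev (h3 : IsLevel3 E) (a b : A.carrier) (x : A.Bar) : E ((ι₂ a * ι₂ b) ⊗ₜ x) = 0 := by
  have : E ∘ₗ TensorProduct.mk _ _ _ (ι₂ a * ι₂ b) = 0 := by
    apply A.word_homog_ind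
    intro l ds _
    simpa [DGAlgebra.word] using h3 [a, b] l (by simp)
  simpa using congrArg (fun φ => φ x) this

theorem tw21 (hE : IsTwistingCochain BD E) (h3 : IsLevel3 E) (a b c : A.carrier) :
    E (ι₂ (a * b) ⊗ₜ ι₂ c) = a * E (ι₂ b ⊗ₜ ι₂ c) + E (ι₂ a ⊗ₜ ι₂ c) * b := by
  have h := congrArg (fun φ => φ ((ι₂ a * ι₂ b) ⊗ₜ ι₂ c)) hE.twist
  simp [BarData.dBB, BD.sgnB_id, BarData.ΔBB_expand, BarData.Δ1, BarData.Δ2, TensorProduct.add_tmul,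
    TensorProduct.tmul_add, BarData.midTw_tmul, BarData.dB1, BarData.dB2, hE.unit_left,
    hE.unit_right, BarData.α0, BarData.α1, BarData.α2, lev h3] at h
  rw [h]

theorem hassoc (h3 : IsLevel3 E) (hN : IsNormalized E) (f : BarMult BD) (hf : BD.α ∘ₗ f.f = E)
    (ha : f.f ∘ₗ TensorProduct.map f.f LinearMap.id ∘ₗ
        TensorProduct.map (TensorProduct.map A.nincl A.nincl) A.nincl =
      f.f ∘ₗ TensorProduct.map LinearMap.id f.f ∘ₗ
        (TensorProduct.assoc (ZMod 2) A.Bar A.Bar A.Bar).toLinearMap ∘ₗ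
        TensorProduct.map (TensorProduct.map A.nincl A.nincl) A.nincl) (a b c : A.carrier) :
    E (ι₂ (E (ι₂ a ⊗ₜ ι₂ b)) ⊗ₜ ι₂ c) = E (ι₂ a ⊗ₜ ι₂ (E (ι₂ b ⊗ₜ ι₂ c))) +
      (E (ι₂ a ⊗ₜ (ι₂ b * ι₂ c)) + E (ι₂ a ⊗ₜ (ι₂ c * ι₂ b))) := by
  have hf' : ∀ u, BD.α (f.f u) = E u := fun u => by rw [← hf]; rfl
  have key : ∀ a b c : A.augIdeal,
      E (ι₂ (E (ι₂ (a : A.carrier) ⊗ₜ ι₂ (b : A.carrier))) ⊗ₜ ι₂ (c : A.carrier)) = 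
      E (ι₂ (a : A.carrier) ⊗ₜ ι₂ (E (ι₂ (b : A.carrier) ⊗ₜ ι₂ (c : A.carrier)))) +
      (E (ι₂ (a : A.carrier) ⊗ₜ (ι₂ (b : A.carrier) * ι₂ (c : A.carrier))) +
       E (ι₂ (a : A.carrier) ⊗ₜ (ι₂ (c : A.carrier) * ι₂ (b : A.carrier)))) := by
    intro a b c
    have h := congrArg (fun φ => BD.α (φ ((ι₂ a ⊗ₜ ι₂ b) ⊗ₜ ι₂ c))) ha
    have h11 : ∀ x y : A.carrier, f.f (ι₂ x ⊗ₜ ι₂ y) =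
        ι₂ x * ι₂ y + ι₂ y * ι₂ x + ι₂ (E (ι₂ x ⊗ₜ ι₂ y)) := fun x y => by
      rw [← hf']; exact f.f11 x y
    simp [DGAlgebra.nincl, hf', h11, BarData.α1, BarData.α2, TensorProduct.add_tmul, TensorProduct.tmul_add,
      lev h3] at h
    rw [h]; abel
  have v1 : ∀ x, E (ι₂ 1 ⊗ₜ ι₂ x) = 0 := fun x => by
    simpa [DGAlgebra.word] using hN.vanish [1] [x] (by simp) (by simp)
  have v2 : ∀ x, E (ι₂ x ⊗ₜ ι₂ 1) = 0 := fun x => by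
    simpa [DGAlgebra.word] using hN.vanish [x] [1] (by simp) (by simp)
  have v3 : ∀ x y, E (ι₂ 1 ⊗ₜ (ι₂ x * ι₂ y)) = 0 := fun x y => by
    simpa [DGAlgebra.word] using hN.vanish [1] [x, y] (by simp) (by simp)
  have v4 : ∀ x y, E (ι₂ x ⊗ₜ (ι₂ 1 * ι₂ y)) = 0 := fun x y => by
    simpa [DGAlgebra.word] using hN.vanish [x] [1, y] (by simp) (by simp)
  have v5 : ∀ x y, E (ι₂ x ⊗ₜ (ι₂ y * ι₂ 1)) = 0 := fun x y => by
    simpa [DGAlgebra.word] using hN.vanish [x] [y, 1] (by simp) (by simp)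
  have dec : ∀ x : A.carrier, ∃ (r : ZMod 2) (y : A.augIdeal), x = r • 1 + (y : A.carrier) := by
    intro x
    refine ⟨A.aug x, ⟨x - A.aug x • 1, ?_⟩, by simp⟩
    simp [DGAlgebra.augIdeal]
  obtain ⟨r, a, rfl⟩ := dec a
  obtain ⟨s, b, rfl⟩ := dec b
  obtain ⟨t, c, rfl⟩ := dec c
  simp only [map_add, map_smul, TensorProduct.add_tmul, TensorProduct.tmul_add, add_mul, mul_add,
    smul_mul_assoc, mul_smul_comm, TensorProduct.tmul_smul, ← TensorProduct.smul_tmul', v1, v2, v3,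
    v4, v5, smul_zero, add_zero, zero_add, key]
end HGA
section Tens
local notation "ι₂" => TensorAlgebra.ι (ZMod 2)
variable {A' A'' : DGAlgebra (ZMod 2)} {T : TensorDGA A' A''}

theorem T_mul (a' b' : A'.carrier) (a'' b'' : A''.carrier) :
    T.e.symm (a' ⊗ₜ a'') * T.e.symm (b' ⊗ₜ b'') = T.e.symm ((a' * b') ⊗ₜ (a'' * b'')) := by
  refine A''.ind (P := fun a'' => T.e.symm (a' ⊗ₜ a'') * T.e.symm (b' ⊗ₜ b'') =
    T.e.symm ((a' * b') ⊗ₜ (a'' * b''))) a'' ?_ (by simp)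
    (fun x y hx hy => by simp only [map_add, add_mul, TensorProduct.tmul_add, hx, hy])
  intro i a'' ha
  refine A'.ind (P := fun b' => T.e.symm (a' ⊗ₜ a'') * T.e.symm (b' ⊗ₜ b'') =
    T.e.symm ((a' * b') ⊗ₜ (a'' * b''))) b' ?_ (by simp)
    (fun x y hx hy => by simp only [map_add, mul_add, TensorProduct.add_tmul, hx, hy])
  intro j b' hb
  rw [T.mul_compat a' b'' ha hb, pm_smul]

theorem T_d (a' : A'.carrier) (a'' : A''.carrier) :
    T.A.d (T.e.symm (a' ⊗ₜ a'')) = T.e.symm (A'.d a' ⊗ₜ a'') + T.e.symm (a' ⊗ₜ A''.d a'') := by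
  refine A'.ind (P := fun a' => T.A.d (T.e.symm (a' ⊗ₜ a'')) =
    T.e.symm (A'.d a' ⊗ₜ a'') + T.e.symm (a' ⊗ₜ A''.d a'')) a' ?_ (by simp)
    (fun x y hx hy => by simp only [map_add, TensorProduct.add_tmul, hx, hy]; abel)
  intro i a' ha
  rw [T.d_compat a'' ha, pm_smul]

variable {BD' : BarData A'} {BD'' : BarData A''} {BD : BarData T.A}
    {E' : A'.Bar ⊗[ZMod 2] A'.Bar →ₗ[ZMod 2] A'.carrier}
    {E'' : A''.Bar ⊗[ZMod 2] A''.Bar →ₗ[ZMod 2] A''.carrier}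
    (GD : GData BD' BD'' T BD E' E'')

theorem Emu0 (F) : GD.Emu F 1 = T.e.symm (F 1 ⊗ₜ 1) := by
  have := GD.Emu_word F [] [] [] [] rfl A'.homog_nil A''.homog_nil
  rw [pm_smul] at this
  simpa [DGAlgebra.word, TensorDGA.mixList] using this

theorem muE0 (F) : GD.muE F 1 = T.e.symm (1 ⊗ₜ F 1) := by
  have := GD.muE_word F [] [] [] [] rfl A'.homog_nil A''.homog_nil
  rw [pm_smul] at this
  simpa [DGAlgebra.word, TensorDGA.mixList] using this

theorem Emu1 (F) (a' : A'.carrier) (a'' : A''.carrier) :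
    GD.Emu F (ι₂ (T.e.symm (a' ⊗ₜ a''))) = T.e.symm (F (ι₂ a') ⊗ₜ a'') := by
  refine A'.ind (P := fun a' => GD.Emu F (ι₂ (T.e.symm (a' ⊗ₜ a''))) =
    T.e.symm (F (ι₂ a') ⊗ₜ a'')) a' ?_ (by simp)
    (fun x y hx hy => by simp only [map_add, TensorProduct.add_tmul, hx, hy])
  intro i a' ha
  refine A''.ind (P := fun a'' => GD.Emu F (ι₂ (T.e.symm (a' ⊗ₜ a''))) =
    T.e.symm (F (ι₂ a') ⊗ₜ a'')) a'' ?_ (by simp)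
    (fun x y hx hy => by simp only [map_add, TensorProduct.tmul_add, hx, hy])
  intro j a'' ha'
  have := GD.Emu_word F [a'] [a''] [i] [j] rfl (A'.homog_cons ha A'.homog_nil)
    (A''.homog_cons ha' A''.homog_nil)
  rw [pm_smul] at this
  simpa [DGAlgebra.word, TensorDGA.mixList] using this

theorem muE1 (F) (a' : A'.carrier) (a'' : A''.carrier) :
    GD.muE F (ι₂ (T.e.symm (a' ⊗ₜ a''))) = T.e.symm (a' ⊗ₜ F (ι₂ a'')) := by
  refine A'.ind (P := fun a' => GD.muE F (ι₂ (T.e.symm (a' ⊗ₜ a''))) =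
    T.e.symm (a' ⊗ₜ F (ι₂ a''))) a' ?_ (by simp)
    (fun x y hx hy => by simp only [map_add, TensorProduct.add_tmul, hx, hy])
  intro i a' ha
  refine A''.ind (P := fun a'' => GD.muE F (ι₂ (T.e.symm (a' ⊗ₜ a''))) =
    T.e.symm (a' ⊗ₜ F (ι₂ a''))) a'' ?_ (by simp)
    (fun x y hx hy => by simp only [map_add, TensorProduct.tmul_add, hx, hy])
  intro j a'' ha'
  have := GD.muE_word F [a'] [a''] [i] [j] rfl (A'.homog_cons ha A'.homog_nil)
    (A''.homog_cons ha' A''.homog_nil)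
  rw [pm_smul] at this
  simpa [DGAlgebra.word, TensorDGA.mixList] using this

/-- Four-variable additive extension from homogeneous elements. -/
theorem ind4 {P : A'.carrier → A''.carrier → A'.carrier → A''.carrier → Prop}
    (a' : A'.carrier) (a'' : A''.carrier) (b' : A'.carrier) (b'' : A''.carrier)
    (hh : ∀ i j k l a' a'' b' b'', a' ∈ A'.grading i → a'' ∈ A''.grading j → b' ∈ A'.grading k →
      b'' ∈ A''.grading l → P a' a'' b' b'')
    (z1 : ∀ y z w, P 0 y z w) (z2 : ∀ x z w, P x 0 z w) (z3 : ∀ x y w, P x y 0 w)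
    (z4 : ∀ x y z, P x y z 0)
    (s1 : ∀ x x' y z w, P x y z w → P x' y z w → P (x + x') y z w)
    (s2 : ∀ x y y' z w, P x y z w → P x y' z w → P x (y + y') z w)
    (s3 : ∀ x y z z' w, P x y z w → P x y z' w → P x y (z + z') w)
    (s4 : ∀ x y z w w', P x y z w → P x y z w' → P x y z (w + w')) : P a' a'' b' b'' := by
  refine A'.ind (P := fun a' => P a' a'' b' b'') a' (fun i a' ha' => ?_) (z1 _ _ _)
    (fun x x' => s1 x x' _ _ _)
  refine A''.ind (P := fun a'' => P a' a'' b' b'') a'' (fun j a'' ha'' => ?_) (z2 _ _ _)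
    (fun x x' => s2 _ x x' _ _)
  refine A'.ind (P := fun b' => P a' a'' b' b'') b' (fun k b' hb' => ?_) (z3 _ _ _)
    (fun x x' => s3 _ _ x x' _)
  refine A''.ind (P := fun b'' => P a' a'' b' b'') b'' (fun l b'' hb'' => ?_) (z4 _ _ _)
    (fun x x' => s4 _ _ _ x x')
  exact hh i j k l _ _ _ _ ha' ha'' hb' hb''

theorem Emu2 (F) (a' b' : A'.carrier) (a'' b'' : A''.carrier) :
    GD.Emu F (ι₂ (T.e.symm (a' ⊗ₜ a'')) * ι₂ (T.e.symm (b' ⊗ₜ b''))) =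
      T.e.symm (F (ι₂ a' * ι₂ b') ⊗ₜ (a'' * b'')) := by
  refine ind4 (P := fun a' a'' b' b'' =>
    GD.Emu F (ι₂ (T.e.symm (a' ⊗ₜ a'')) * ι₂ (T.e.symm (b' ⊗ₜ b''))) =
      T.e.symm (F (ι₂ a' * ι₂ b') ⊗ₜ (a'' * b''))) a' a'' b' b'' ?_ ?_ ?_ ?_ ?_ ?_ ?_ ?_ ?_
  · intro i j k l a' a'' b' b'' ha ha' hb hb'
    have := GD.Emu_word F [a', b'] [a'', b''] [i, k] [j, l] rfl
      (A'.homog_cons ha (A'.homog_cons hb A'.homog_nil))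
      (A''.homog_cons ha' (A''.homog_cons hb' A''.homog_nil))
    rw [pm_smul] at this
    simpa [DGAlgebra.word, TensorDGA.mixList] using this
  · intros; simp
  · intros; simp
  · intros; simp
  · intros; simp
  all_goals
    intro _ _ _ _ _ hx hy
    simp only [map_add, TensorProduct.tmul_add, TensorProduct.add_tmul, add_mul, mul_add, hx, hy]

theorem muE2 (F) (a' b' : A'.carrier) (a'' b'' : A''.carrier) :
    GD.muE F (ι₂ (T.e.symm (a' ⊗ₜ a'')) * ι₂ (T.e.symm (b' ⊗ₜ b''))) =
      T.e.symm ((a' * b') ⊗ₜ F (ι₂ a'' * ι₂ b'')) := by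
  refine ind4 (P := fun a' a'' b' b'' =>
    GD.muE F (ι₂ (T.e.symm (a' ⊗ₜ a'')) * ι₂ (T.e.symm (b' ⊗ₜ b''))) =
      T.e.symm ((a' * b') ⊗ₜ F (ι₂ a'' * ι₂ b''))) a' a'' b' b'' ?_ ?_ ?_ ?_ ?_ ?_ ?_ ?_ ?_
  · intro i j k l a' a'' b' b'' ha ha' hb hb'
    have := GD.muE_word F [a', b'] [a'', b''] [i, k] [j, l] rfl
      (A'.homog_cons ha (A'.homog_cons hb A'.homog_nil))
      (A''.homog_cons ha' (A''.homog_cons hb' A''.homog_nil))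
    rw [pm_smul] at this
    simpa [DGAlgebra.word, TensorDGA.mixList] using this
  · intros; simp
  · intros; simp
  · intros; simp
  · intros; simp
  all_goals
    intro _ _ _ _ _ hx hy
    simp only [map_add, TensorProduct.tmul_add, TensorProduct.add_tmul, add_mul, mul_add, hx, hy]

/-- `E([a], x)` for a homogeneous pure tensor. -/
theorem G1 {n' n'' : ℤ} {a' : A'.carrier} {a'' : A''.carrier}
    (ha' : a' ∈ A'.grading n') (ha'' : a'' ∈ A''.grading n'') :
    GD.G (ι₂ (T.e.symm (a' ⊗ₜ a''))) =
    TensorProduct.map (GD.Emu (E' ∘ₗ TensorProduct.mk (ZMod 2) A'.Bar A'.Bar (ι₂ a')))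
      (TensorProduct.map LinearMap.id
        (GD.muE (E'' ∘ₗ TensorProduct.mk (ZMod 2) A''.Bar A''.Bar (ι₂ a'')))) ∘ₗ
    TensorProduct.map LinearMap.id BD.Δ ∘ₗ BD.Δ := by
  have := GD.G_single a' a'' ha' ha''
  simp only [Gone, BD.sgnPow_id] at this
  simpa [DGAlgebra.word] using this

variable (hE' : IsTwistingCochain BD' E') (hE'' : IsTwistingCochain BD'' E'')

theorem Ec1 (x : T.A.Bar) (a : T.A.carrier) : Econstr GD (ι₂ a ⊗ₜ x) =
    εBAAA T BD (GD.G (ι₂ a) x) := by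
  simp [Econstr, BarData.ε1]

theorem Ec2 (x : T.A.Bar) (a b : T.A.carrier) : Econstr GD ((ι₂ a * ι₂ b) ⊗ₜ x) =
    εBAAA T BD (GD.G (ι₂ a * ι₂ b) x) := by
  simp [Econstr, BarData.ε2]

include hE' hE''
theorem Ec11 (a' b' : A'.carrier) (a'' b'' : A''.carrier) :
    Econstr GD (ι₂ (T.e.symm (a' ⊗ₜ a'')) ⊗ₜ ι₂ (T.e.symm (b' ⊗ₜ b''))) =
      T.e.symm ((a' * b') ⊗ₜ E'' (ι₂ a'' ⊗ₜ ι₂ b'')) +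
      T.e.symm (E' (ι₂ a' ⊗ₜ ι₂ b') ⊗ₜ (b'' * a'')) := by
  refine A'.ind (P := fun a' =>
    Econstr GD (ι₂ (T.e.symm (a' ⊗ₜ a'')) ⊗ₜ ι₂ (T.e.symm (b' ⊗ₜ b''))) =
      T.e.symm ((a' * b') ⊗ₜ E'' (ι₂ a'' ⊗ₜ ι₂ b'')) +
      T.e.symm (E' (ι₂ a' ⊗ₜ ι₂ b') ⊗ₜ (b'' * a''))) a' ?_ (by simp) ?_
  rotate_left
  · intro x y hx hy
    simp only [map_add, TensorProduct.tmul_add, TensorProduct.add_tmul, add_mul, mul_add, hx, hy]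
    abel
  intro i a' ha'
  refine A''.ind (P := fun a'' =>
    Econstr GD (ι₂ (T.e.symm (a' ⊗ₜ a'')) ⊗ₜ ι₂ (T.e.symm (b' ⊗ₜ b''))) =
      T.e.symm ((a' * b') ⊗ₜ E'' (ι₂ a'' ⊗ₜ ι₂ b'')) +
      T.e.symm (E' (ι₂ a' ⊗ₜ ι₂ b') ⊗ₜ (b'' * a''))) a'' ?_ (by simp) ?_
  rotate_left
  · intro x y hx hy
    simp only [map_add, TensorProduct.tmul_add, TensorProduct.add_tmul, add_mul, mul_add, hx, hy]
    abel
  intro j a'' ha''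
  rw [Ec1, G1 GD ha' ha'']
  simp [εBAAA, BarData.Δ0, BarData.Δ1, TensorProduct.tmul_add, Emu0, Emu1, muE0, muE1,
    BarData.εB_one, BarData.ε1, hE'.unit_right, hE''.unit_right, BarData.α1, T_mul]

theorem Ec12 (a' b' c' : A'.carrier) (a'' b'' c'' : A''.carrier) :
    Econstr GD (ι₂ (T.e.symm (a' ⊗ₜ a'')) ⊗ₜ (ι₂ (T.e.symm (b' ⊗ₜ b'')) * ι₂ (T.e.symm (c' ⊗ₜ c'')))) =
      T.e.symm ((a' * (b' * c')) ⊗ₜ E'' (ι₂ a'' ⊗ₜ (ι₂ b'' * ι₂ c''))) +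
      T.e.symm ((E' (ι₂ a' ⊗ₜ ι₂ b') * c') ⊗ₜ (b'' * E'' (ι₂ a'' ⊗ₜ ι₂ c''))) +
      T.e.symm (E' (ι₂ a' ⊗ₜ (ι₂ b' * ι₂ c')) ⊗ₜ (b'' * c'' * a'')) := by
  refine A'.ind (P := fun a' =>
    Econstr GD (ι₂ (T.e.symm (a' ⊗ₜ a'')) ⊗ₜ (ι₂ (T.e.symm (b' ⊗ₜ b'')) * ι₂ (T.e.symm (c' ⊗ₜ c'')))) =
      T.e.symm ((a' * (b' * c')) ⊗ₜ E'' (ι₂ a'' ⊗ₜ (ι₂ b'' * ι₂ c''))) +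
      T.e.symm ((E' (ι₂ a' ⊗ₜ ι₂ b') * c') ⊗ₜ (b'' * E'' (ι₂ a'' ⊗ₜ ι₂ c''))) +
      T.e.symm (E' (ι₂ a' ⊗ₜ (ι₂ b' * ι₂ c')) ⊗ₜ (b'' * c'' * a''))) a' ?_ (by simp) ?_
  rotate_left
  · intro x y hx hy
    simp only [map_add, TensorProduct.tmul_add, TensorProduct.add_tmul, add_mul, mul_add, hx, hy]
    abel
  intro i a' ha'
  refine A''.ind (P := fun a'' =>
    Econstr GD (ι₂ (T.e.symm (a' ⊗ₜ a'')) ⊗ₜ (ι₂ (T.e.symm (b' ⊗ₜ b'')) * ι₂ (T.e.symm (c' ⊗ₜ c'')))) =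
      T.e.symm ((a' * (b' * c')) ⊗ₜ E'' (ι₂ a'' ⊗ₜ (ι₂ b'' * ι₂ c''))) +
      T.e.symm ((E' (ι₂ a' ⊗ₜ ι₂ b') * c') ⊗ₜ (b'' * E'' (ι₂ a'' ⊗ₜ ι₂ c''))) +
      T.e.symm (E' (ι₂ a' ⊗ₜ (ι₂ b' * ι₂ c')) ⊗ₜ (b'' * c'' * a''))) a'' ?_ (by simp) ?_
  rotate_left
  · intro x y hx hy
    simp only [map_add, TensorProduct.tmul_add, TensorProduct.add_tmul, add_mul, mul_add, hx, hy]
    abel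
  intro j a'' ha''
  rw [Ec1, G1 GD ha' ha'']
  simp [εBAAA, BarData.Δ0, BarData.Δ1, BarData.Δ2, TensorProduct.tmul_add, Emu0, Emu1, Emu2, muE0,
    muE1, muE2, BarData.εB_one, BarData.ε1, BarData.ε2, hE'.unit_right, hE''.unit_right,
    BarData.α1, T_mul]

theorem Ec21 (hN'' : IsNormalized E'') (a' b' c' : A'.carrier) (a'' b'' c'' : A''.carrier) :
    Econstr GD ((ι₂ (T.e.symm (a' ⊗ₜ a'')) * ι₂ (T.e.symm (b' ⊗ₜ b''))) ⊗ₜ ι₂ (T.e.symm (c' ⊗ₜ c''))) =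
      T.e.symm ((a' * E' (ι₂ b' ⊗ₜ ι₂ c')) ⊗ₜ (E'' (ι₂ a'' ⊗ₜ ι₂ c'') * b'')) := by
  have v2 : ∀ x, E'' (ι₂ x ⊗ₜ ι₂ 1) = 0 := fun x => by
    simpa [DGAlgebra.word] using hN''.vanish [x] [1] (by simp) (by simp)
  have v4 : ∀ x y, E'' (ι₂ x ⊗ₜ (ι₂ 1 * ι₂ y)) = 0 := fun x y => by
    simpa [DGAlgebra.word] using hN''.vanish [x] [1, y] (by simp) (by simp)
  have v5 : ∀ x y, E'' (ι₂ x ⊗ₜ (ι₂ y * ι₂ 1)) = 0 := fun x y => by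
    simpa [DGAlgebra.word] using hN''.vanish [x] [y, 1] (by simp) (by simp)
  refine ind4 (P := fun a' a'' b' b'' =>
    Econstr GD ((ι₂ (T.e.symm (a' ⊗ₜ a'')) * ι₂ (T.e.symm (b' ⊗ₜ b''))) ⊗ₜ ι₂ (T.e.symm (c' ⊗ₜ c''))) =
      T.e.symm ((a' * E' (ι₂ b' ⊗ₜ ι₂ c')) ⊗ₜ (E'' (ι₂ a'' ⊗ₜ ι₂ c'') * b'')))
      a' a'' b' b'' ?_ ?_ ?_ ?_ ?_ ?_ ?_ ?_ ?_
  · intro i j k l a' a'' b' b'' ha' ha'' hb' hb''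
    have h := GD.G_cons a' a'' [T.e.symm (b' ⊗ₜ b'')] [k + l] ha' ha''
      (T.A.homog_cons (T.grading_compat hb' hb'') T.A.homog_nil) (by simp)
    simp only [Mop, BD.sgnPow_id] at h
    simp only [DGAlgebra.word, List.map_cons, List.map_nil, List.prod_cons, List.prod_nil,
      mul_one, G1 GD hb' hb''] at h
    rw [Ec2, h]
    simp [εBAAA, BarData.Δ0, BarData.Δ1, BarData.Δ2, TensorProduct.tmul_add, TensorProduct.add_tmul,
      Emu0, Emu1, Emu2, muE0,
      muE1, muE2, BarData.εB_one, BarData.ε1, BarData.ε2, hE'.unit_right, hE''.unit_right,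
      BarData.α1, T_mul, DGAlgebra.concat, v2, v4, v5]
  · intros; simp
  · intros; simp
  · intros; simp
  · intros; simp
  all_goals
    intro _ _ _ _ _ hx hy
    simp only [map_add, TensorProduct.tmul_add, TensorProduct.add_tmul, add_mul, mul_add, hx, hy]
end Tens
theorem eq_of_add {M : Type*} [AddCommGroup M] [Module (ZMod 2) M] {x y : M} (h : x + y = 0) :
    x = y := by
  have := add_eq_of h
  rwa [add_zero] at this

/-- **Remark after Example 3.2, over `ℤ/2`.**  Let `A'` and `A''` be
homotopy Gerstenhaber algebras over `ℤ/2` — level-3 Hirsch algebras whose bar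
multiplications `f'`, `f''` are associative (on the normalized bar construction) — and
equip `A = A' ⊗ A''` with the Hirsch multiplication `fm` (twisting cochain `Econstr`)
of the tensor-product construction.  Then for `a = a'⊗a''`, `b = b'⊗b''`,
`c = c'⊗c'' ∈ A` one has
`([a]·[b])·[c] + [a]·([b]·[c]) = d(h)([a],[b],[c])`
where `h([a],[b],[c]) = [a'E'([b'],[c']) ⊗ E''([a''],[c''|b''])]
                      + [E'([a'],[b'|c']) ⊗ E''([b''],[c''])a'']`
(over `ℤ/2` all signs are trivial, `d(h) = d_B ∘ h + h ∘ d` where `d` acts on each bar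
argument through the differential of `A = A' ⊗ A''`). -/
theorem tensor_hga_homotopy_associative {A' A'' : DGAlgebra (ZMod 2)}
    (BD' : BarData A') (BD'' : BarData A'') (T : TensorDGA A' A'') (BD : BarData T.A)
    (E' : A'.Bar ⊗[ZMod 2] A'.Bar →ₗ[ZMod 2] A'.carrier)
    (E'' : A''.Bar ⊗[ZMod 2] A''.Bar →ₗ[ZMod 2] A''.carrier)
    (hE' : IsTwistingCochain BD' E') (hE'' : IsTwistingCochain BD'' E'')
    (h3' : IsLevel3 E') (h3'' : IsLevel3 E'')
    (hN' : IsNormalized E') (hN'' : IsNormalized E'')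
    (f' : BarMult BD') (hf' : BD'.α ∘ₗ f'.f = E')
    (f'' : BarMult BD'') (hf'' : BD''.α ∘ₗ f''.f = E'')
    -- `A'` and `A''` are homotopy Gerstenhaber algebras: the multiplications of their
    -- (normalized) bar constructions are associative
    (hassoc' : f'.f ∘ₗ TensorProduct.map f'.f LinearMap.id ∘ₗ
        TensorProduct.map (TensorProduct.map A'.nincl A'.nincl) A'.nincl =
      f'.f ∘ₗ TensorProduct.map LinearMap.id f'.f ∘ₗ
        (TensorProduct.assoc (ZMod 2) A'.Bar A'.Bar A'.Bar).toLinearMap ∘ₗ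
        TensorProduct.map (TensorProduct.map A'.nincl A'.nincl) A'.nincl)
    (hassoc'' : f''.f ∘ₗ TensorProduct.map f''.f LinearMap.id ∘ₗ
        TensorProduct.map (TensorProduct.map A''.nincl A''.nincl) A''.nincl =
      f''.f ∘ₗ TensorProduct.map LinearMap.id f''.f ∘ₗ
        (TensorProduct.assoc (ZMod 2) A''.Bar A''.Bar A''.Bar).toLinearMap ∘ₗ
        TensorProduct.map (TensorProduct.map A''.nincl A''.nincl) A''.nincl)
    (GD : GData BD' BD'' T BD E' E'')
    (fm : BarMult BD) (hfm : BD.α ∘ₗ fm.f = Econstr GD)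
    (a' b' c' : A'.carrier) (a'' b'' c'' : A''.carrier) :
    fm.f (fm.f (T.A.word [T.e.symm (a' ⊗ₜ[ZMod 2] a'')] ⊗ₜ[ZMod 2]
            T.A.word [T.e.symm (b' ⊗ₜ[ZMod 2] b'')]) ⊗ₜ[ZMod 2]
          T.A.word [T.e.symm (c' ⊗ₜ[ZMod 2] c'')])
    + fm.f (T.A.word [T.e.symm (a' ⊗ₜ[ZMod 2] a'')] ⊗ₜ[ZMod 2]
        fm.f (T.A.word [T.e.symm (b' ⊗ₜ[ZMod 2] b'')] ⊗ₜ[ZMod 2]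
          T.A.word [T.e.symm (c' ⊗ₜ[ZMod 2] c'')])) =
      BD.dB (hTerm T E' E'' a' b' c' a'' b'' c'')
      + hTerm T E' E'' (A'.d a') b' c' a'' b'' c''
      + hTerm T E' E'' a' (A'.d b') c' a'' b'' c''
      + hTerm T E' E'' a' b' (A'.d c') a'' b'' c''
      + hTerm T E' E'' a' b' c' (A''.d a'') b'' c''
      + hTerm T E' E'' a' b' c' a'' (A''.d b'') c''
      + hTerm T E' E'' a' b' c' a'' b'' (A''.d c'') := by
  simp only [hTerm, DGAlgebra.word, List.map_cons, List.map_nil, List.prod_cons, List.prod_nil,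
    mul_one]
  have hm : ∀ u, BD.α (fm.f u) = Econstr GD u := fun u => by rw [← hfm]; rfl
  have m11 := fm.f11
  have m12 := fm.f12
  have m21 := fm.f21
  simp only [hm] at m11 m12 m21
  simp only [m11, m12, m21, TensorProduct.add_tmul, TensorProduct.tmul_add, map_add, mul_add, add_mul,
    Ec11 GD hE' hE'', Ec12 GD hE' hE'', Ec21 GD hE' hE'' hN'', BarData.dB1, T_d, leib,
    tw11 hE', tw11 hE'', tw12 hE', tw12 hE'', tw21 hE' h3', tw21 hE'' h3'',
    hassoc h3' hN' f' hf' hassoc', hassoc h3'' hN'' f'' hf'' hassoc'', mul_assoc]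
  apply eq_of_add
  abel_nf
  have h2 : ∀ x : T.A.Bar, x + x = 0 := fun x => ZModModule.add_self x
  simp only [two_smul, h2, add_zero]
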